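/- Let F_n denote the number of spanning forests of the 2×n grid graph G_2(n) that have exactly two connected components such that the two rightmost vertices v_{1,n} and v_{2,n} lie in distinct components. Then F_1 = 1, F_2 = 3, and for every n ≥ 3, F_n = 4·F_{n-1} − F_{n-2}. -/

import Mathlib

open SimpleGraph

/-- The number of spanning forests of the `2 × n` grid graph `G_2(n) = P_2 □ P_n` having
exactly two connected components such that the two rightmost vertices `v_{1,n}` and `v_{2,n}`
lie in distinct components. -/
noncomputable def gridForestCount : ℕ → ℕ
  | 0 => 0
  | (n + 1) =>
    Nat.card {H : (pathGraph 2 □ pathGraph (n + 1)).Subgraph //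
      H.IsSpanning ∧ H.spanningCoe.IsAcyclic ∧
      Nat.card H.spanningCoe.ConnectedComponent = 2 ∧
      ¬ H.spanningCoe.Reachable (0, Fin.last n) (1, Fin.last n)}

namespace SimpleGraph

variable {V W : Type*} {G : SimpleGraph V} {H : SimpleGraph W}

theorem Reachable.map_of_adj_reachable (f : V → W)
    (hf : ∀ x y, G.Adj x y → H.Reachable (f x) (f y)) {x y : V} (h : G.Reachable x y) :
    H.Reachable (f x) (f y) := by
  obtain ⟨p⟩ := h
  induction p with
  | nil => exact .refl _
  | cons hadj _ ih => exact (hf _ _ hadj).trans ih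

theorem Connected.of_map_adj_reachable (hG : G.Connected) (f : V → W)
    (hf : ∀ x y, G.Adj x y → H.Reachable (f x) (f y))
    (hsurj : ∀ w, ∃ v, H.Reachable w (f v)) : H.Connected := by
  have := hG.nonempty
  have : Nonempty W := this.map f
  refine ⟨fun a b ↦ ?_⟩
  obtain ⟨x, hx⟩ := hsurj a
  obtain ⟨y, hy⟩ := hsurj b
  exact hx.trans (((hG.preconnected x y).map_of_adj_reachable f hf).trans hy.symm)

theorem Reachable.iff_of_adj (p : V → Prop) (hp : ∀ x y, G.Adj x y → (p x ↔ p y)) {x y : V}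
    (h : G.Reachable x y) : p x ↔ p y := by
  obtain ⟨w⟩ := h
  induction w with
  | nil => rfl
  | cons hadj _ ih => exact (hp _ _ hadj).trans ih

theorem edgeSet_sup_edge {u v : V} (huv : u ≠ v) :
    (G ⊔ edge u v).edgeSet = insert s(u, v) G.edgeSet := by
  rw [edgeSet_sup, edgeSet_edge_of_ne huv, Set.union_comm, Set.singleton_union]

theorem Connected.reachable_or_reachable_of_sup_edge {u v : V} (h : (G ⊔ edge u v).Connected)
    (x : V) : G.Reachable x u ∨ G.Reachable x v := by
  have key := (h.preconnected x u).iff_of_adj (fun y ↦ G.Reachable y u ∨ G.Reachable y v) ?_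
  · exact key.2 (.inl (.refl _))
  · intro a b hab
    rw [sup_adj, edge_adj] at hab
    rcases hab with hab | ⟨⟨rfl, rfl⟩ | ⟨rfl, rfl⟩, _⟩
    · exact ⟨Or.imp hab.symm.reachable.trans hab.symm.reachable.trans,
        Or.imp hab.reachable.trans hab.reachable.trans⟩
    · exact ⟨fun _ ↦ .inr (.refl _), fun _ ↦ .inl (.refl _)⟩
    · exact ⟨fun _ ↦ .inl (.refl _), fun _ ↦ .inr (.refl _)⟩

/-- A two-component forest separating `u` from `v` is the same as a graph with `|V| - 2` edges
which becomes connected once `u` and `v` are joined. -/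
theorem isAcyclic_and_card_connectedComponent_eq_two_iff [Finite V] {u v : V} (huv : u ≠ v) :
    (G.IsAcyclic ∧ Nat.card G.ConnectedComponent = 2 ∧ ¬ G.Reachable u v) ↔
      (G ⊔ edge u v).Connected ∧ G.edgeSet.ncard + 2 = Nat.card V := by
  constructor
  · rintro ⟨hac, hcard, hnr⟩
    have hnadj : s(u, v) ∉ G.edgeSet := fun h ↦ hnr (Adj.reachable h)
    have hle : G ≤ G ⊔ edge u v := le_sup_left
    have hconn : (G ⊔ edge u v).Connected := by
      have hne : G.connectedComponentMk u ≠ G.connectedComponentMk v :=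
        fun h ↦ hnr (ConnectedComponent.exact h)
      have huniv : ({G.connectedComponentMk u, G.connectedComponentMk v} : Set _) = Set.univ := by
        apply Set.eq_of_subset_of_ncard_le (Set.subset_univ _)
        rw [Set.ncard_univ, hcard, Set.ncard_pair hne]
      have huv' : (G ⊔ edge u v).Reachable v u :=
        Adj.reachable (Or.inr (by simp [edge_adj, huv.symm]))
      have hu : ∀ x, (G ⊔ edge u v).Reachable x u := fun x ↦ by
        have hx : G.connectedComponentMk x ∈
          ({G.connectedComponentMk u, G.connectedComponentMk v} : Set _) := huniv ▸ Set.mem_univ _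
        rcases hx with hx | hx
        · exact (ConnectedComponent.exact hx).mono hle
        · exact ((ConnectedComponent.exact hx).mono hle).trans huv'
      have : Nonempty V := ⟨u⟩
      exact ⟨fun x y ↦ (hu x).trans (hu y).symm⟩
    refine ⟨hconn, ?_⟩
    have htree : (G ⊔ edge u v).IsTree := ⟨hconn, hac.sup_edge_of_not_reachable hnr⟩
    have := (isTree_iff_connected_and_card.1 htree).2
    rw [Nat.card_coe_set_eq, edgeSet_sup_edge huv, Set.ncard_insert_of_notMem hnadj] at this
    exact this
  · rintro ⟨hconn, hcard⟩
    have hge := hconn.card_vert_le_card_edgeSet_add_one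
    have hnadj : s(u, v) ∉ G.edgeSet := by
      intro hmem
      rw [Nat.card_coe_set_eq, edgeSet_sup_edge huv, Set.insert_eq_of_mem hmem] at hge
      omega
    have htree : (G ⊔ edge u v).IsTree := by
      refine isTree_iff_connected_and_card.2 ⟨hconn, ?_⟩
      rw [Nat.card_coe_set_eq, edgeSet_sup_edge huv, Set.ncard_insert_of_notMem hnadj]
      exact hcard
    have hnr : ¬ G.Reachable u v := by
      have := isAcyclic_iff_forall_isBridge.1 htree.2 (e := s(u, v))
        (by simp [edgeSet_sup_edge huv])
      rw [isBridge_iff] at this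
      refine fun h ↦ this (h.mono fun a b hab ↦ ?_)
      rw [deleteEdges_adj, Set.mem_singleton_iff]
      exact ⟨Or.inl hab, fun h ↦ hnadj (h ▸ hab)⟩
    refine ⟨htree.2.anti le_sup_left, ?_, hnr⟩
    refine Nat.card_eq_two_iff.2 ⟨G.connectedComponentMk u, G.connectedComponentMk v,
      fun h ↦ hnr (ConnectedComponent.exact h), Set.eq_univ_of_forall fun c ↦ ?_⟩
    induction c using ConnectedComponent.ind with
    | h x =>
      exact (hconn.reachable_or_reachable_of_sup_edge x).imp ConnectedComponent.sound
        ConnectedComponent.sound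

end SimpleGraph

namespace GridForest

/-- The edges of the `2 × (n + 1)` grid: the `n + 1` vertical ones, followed by the horizontal
ones, where `(j, i)` stands for the edge of row `i` joining columns `j` and `j + 1`. -/
def gridEdge {n : ℕ} : Fin (n + 1) ⊕ Fin n × Fin 2 → Sym2 (Fin 2 × Fin (n + 1))
  | .inl j => s((0, j), (1, j))
  | .inr (j, i) => s((i, j.castSucc), (i, j.succ))

theorem gridEdge_injective {n : ℕ} : Function.Injective (gridEdge (n := n)) := by
  rintro (j | ⟨j, i⟩) (j' | ⟨j', i'⟩) h <;>
    simp only [gridEdge, Sym2.eq_iff, Prod.mk.injEq, Fin.ext_iff, Fin.val_castSucc,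
      Fin.val_succ, Fin.val_zero, Fin.val_one, Sum.inl.injEq, Sum.inr.injEq, reduceCtorEq] at h ⊢ <;>
    omega

theorem not_isDiag_gridEdge {n : ℕ} (e : Fin (n + 1) ⊕ Fin n × Fin 2) :
    ¬ (gridEdge e).IsDiag := by
  rcases e with j | ⟨j, i⟩ <;> simp [gridEdge, Fin.ext_iff]

/-- The spanning subgraph of the `2 × (n + 1)` grid whose edges are selected by `r` (vertical
edges) and `h` (horizontal edges). -/
def subgrid {n : ℕ} (r : Fin (n + 1) → Bool) (h : Fin n → Fin 2 → Bool) :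
    SimpleGraph (Fin 2 × Fin (n + 1)) :=
  fromEdgeSet (gridEdge '' {e | Sum.elim r (fun p ↦ h p.1 p.2) e = true})

variable {n : ℕ} {r : Fin (n + 1) → Bool} {h : Fin n → Fin 2 → Bool}

theorem edgeSet_subgrid : (subgrid r h).edgeSet =
    gridEdge '' {e | Sum.elim r (fun p ↦ h p.1 p.2) e = true} := by
  rw [subgrid, edgeSet_fromEdgeSet, sdiff_eq_left, Set.disjoint_left]
  rintro _ ⟨e, -, rfl⟩ he
  exact not_isDiag_gridEdge e he

theorem gridEdge_mem_edgeSet_subgrid (e : Fin (n + 1) ⊕ Fin n × Fin 2) :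
    gridEdge e ∈ (subgrid r h).edgeSet ↔ Sum.elim r (fun p ↦ h p.1 p.2) e = true := by
  rw [edgeSet_subgrid, gridEdge_injective.mem_set_image, Set.mem_ofPred_eq]

theorem subgrid_adj_vertical (j : Fin (n + 1)) :
    (subgrid r h).Adj (0, j) (1, j) ↔ r j = true :=
  gridEdge_mem_edgeSet_subgrid (.inl j)

theorem subgrid_adj_horizontal (j : Fin n) (i : Fin 2) :
    (subgrid r h).Adj (i, j.castSucc) (i, j.succ) ↔ h j i = true :=
  gridEdge_mem_edgeSet_subgrid (.inr (j, i))

theorem forall_adj_subgrid {R : Fin 2 × Fin (n + 1) → Fin 2 × Fin (n + 1) → Prop}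
    (hsymm : ∀ x y, R x y → R y x) (hr : ∀ j, r j = true → R (0, j) (1, j))
    (hh : ∀ j i, h j i = true → R (i, j.castSucc) (i, j.succ)) (x y)
    (hxy : (subgrid r h).Adj x y) : R x y := by
  rw [← mem_edgeSet, edgeSet_subgrid] at hxy
  obtain ⟨j | ⟨j, i⟩, he, hxy⟩ := hxy
  · rcases Sym2.eq_iff.1 hxy with ⟨rfl, rfl⟩ | ⟨rfl, rfl⟩
    exacts [hr j he, hsymm _ _ (hr j he)]
  · rcases Sym2.eq_iff.1 hxy with ⟨rfl, rfl⟩ | ⟨rfl, rfl⟩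
    exacts [hh j i he, hsymm _ _ (hh j i he)]

theorem ncard_edgeSet_subgrid : (subgrid r h).edgeSet.ncard =
    ∑ j, (r j).toNat + ∑ j, ((h j 0).toNat + (h j 1).toNat) := by
  have hfilter : {e | Sum.elim r (fun p : Fin n × Fin 2 ↦ h p.1 p.2) e = true} =
      ((Finset.univ.filter fun e ↦ Sum.elim r (fun p : Fin n × Fin 2 ↦ h p.1 p.2) e = true :
        Finset (Fin (n + 1) ⊕ Fin n × Fin 2)) : Set (Fin (n + 1) ⊕ Fin n × Fin 2)) := by
    ext; simp
  rw [edgeSet_subgrid, Set.ncard_image_of_injective _ gridEdge_injective, hfilter,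
    Set.ncard_coe_finset, Finset.card_filter, Fintype.sum_sum_type, Fintype.sum_prod_type]
  simp only [Sum.elim_inl, Sum.elim_inr, Fin.sum_univ_two, Bool.toNat, Bool.cond_eq_ite]
  rfl

theorem subgrid_update_last : subgrid (Function.update r (Fin.last n) true) h =
    subgrid r h ⊔ edge (0, Fin.last n) (1, Fin.last n) := by
  rw [← edgeSet_inj, edgeSet_sup_edge (by simp), edgeSet_subgrid, edgeSet_subgrid,
    show s(((0 : Fin 2), Fin.last n), ((1 : Fin 2), Fin.last n)) = gridEdge (.inl (Fin.last n))
      from rfl, ← Set.image_insert_eq]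
  congr 1
  ext (j | ⟨j, i⟩)
  · change Function.update r (Fin.last n) true j = true ↔
      (Sum.inl j : Fin (n + 1) ⊕ Fin n × Fin 2) = Sum.inl (Fin.last n) ∨ r j = true
    rw [Function.update_apply, Sum.inl.injEq]
    split_ifs with hj
    · exact ⟨fun _ ↦ .inl hj, fun _ ↦ rfl⟩
    · exact ⟨.inr, fun h ↦ h.resolve_left hj⟩
  · change h j i = true ↔
      (Sum.inr (j, i) : Fin (n + 1) ⊕ Fin n × Fin 2) = Sum.inl (Fin.last n) ∨ h j i = true
    exact ⟨.inr, fun h ↦ h.resolve_left (fun h' ↦ nomatch h')⟩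

theorem boxProd_adj_vertical (j : Fin (n + 1)) :
    (pathGraph 2 □ pathGraph (n + 1)).Adj (0, j) (1, j) := by
  simp [boxProd_adj, pathGraph_adj]

theorem boxProd_adj_horizontal (j : Fin n) (i : Fin 2) :
    (pathGraph 2 □ pathGraph (n + 1)).Adj (i, j.castSucc) (i, j.succ) := by
  simp [boxProd_adj, pathGraph_adj]

theorem subgrid_le : subgrid r h ≤ pathGraph 2 □ pathGraph (n + 1) :=
  forall_adj_subgrid (R := (pathGraph 2 □ pathGraph (n + 1)).Adj) (fun _ _ ↦ Adj.symm)
    (fun j _ ↦ boxProd_adj_vertical j) (fun j i _ ↦ boxProd_adj_horizontal j i)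

theorem exists_gridEdge_eq {x y : Fin 2 × Fin (n + 1)}
    (hxy : (pathGraph 2 □ pathGraph (n + 1)).Adj x y) : ∃ e, gridEdge e = s(x, y) := by
  obtain ⟨i, j⟩ := x
  obtain ⟨i', j'⟩ := y
  simp only [boxProd_adj, pathGraph_adj] at hxy
  rcases hxy with ⟨hi, rfl⟩ | ⟨hj | hj, rfl⟩
  · refine ⟨.inl j, Sym2.eq_iff.2 ?_⟩
    fin_cases i <;> fin_cases i' <;> simp_all
  · refine ⟨.inr (⟨j, by omega⟩, i), Sym2.eq_iff.2 (.inl ?_)⟩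
    simp [hj]
  · refine ⟨.inr (⟨j', by omega⟩, i), Sym2.eq_iff.2 (.inr ?_)⟩
    simp [hj]

theorem card_spanning_subgraph (n : ℕ) (P : SimpleGraph (Fin 2 × Fin (n + 1)) → Prop) :
    Nat.card {H : (pathGraph 2 □ pathGraph (n + 1)).Subgraph //
      H.IsSpanning ∧ P H.spanningCoe} =
    Nat.card {c : (Fin (n + 1) → Bool) × (Fin n → Fin 2 → Bool) // P (subgrid c.1 c.2)} := by
  classical
  have hcoe (c : (Fin (n + 1) → Bool) × (Fin n → Fin 2 → Bool)) :
      (toSubgraph (subgrid c.1 c.2) subgrid_le).spanningCoe = subgrid c.1 c.2 := rfl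
  refine (Nat.card_congr (Equiv.ofBijective (fun c ↦ ⟨toSubgraph (subgrid c.1.1 c.1.2) subgrid_le,
    toSubgraph.isSpanning _ _, by rw [hcoe]; exact c.2⟩) ⟨?_, ?_⟩)).symm
  · rintro ⟨⟨r, h⟩, hc⟩ ⟨⟨r', h'⟩, hc'⟩ heq
    have heq : subgrid r h = subgrid r' h' :=
      congrArg (fun H ↦ H.1.spanningCoe) heq
    simp only [Subtype.mk.injEq, Prod.mk.injEq]
    constructor
    · ext j
      rw [Bool.eq_iff_iff, ← subgrid_adj_vertical (h := h), heq, subgrid_adj_vertical]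
    · ext j i
      rw [Bool.eq_iff_iff, ← subgrid_adj_horizontal (r := r), heq, subgrid_adj_horizontal]
  · rintro ⟨H, hsp, hP⟩
    have hH : subgrid (fun j ↦ decide (H.Adj (0, j) (1, j)))
        (fun j i ↦ decide (H.Adj (i, j.castSucc) (i, j.succ))) = H.spanningCoe := by
      rw [← edgeSet_inj, edgeSet_subgrid]
      ext e
      induction e with | h x y => ?_
      constructor
      · rintro ⟨j | ⟨j, i⟩, he, heq⟩
        · rw [← heq]; exact of_decide_eq_true he
        · rw [← heq]; exact of_decide_eq_true he
      · intro hxy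
        obtain ⟨e, he⟩ := exists_gridEdge_eq (H.adj_sub hxy)
        refine ⟨e, ?_, he⟩
        rw [← he] at hxy
        rcases e with j | ⟨j, i⟩ <;> exact decide_eq_true hxy
    refine ⟨⟨(_, _), by rw [hH]; exact hP⟩, Subtype.ext (Subgraph.ext ?_ ?_)⟩
    · exact (Set.eq_univ_of_forall hsp).symm
    · exact congrArg SimpleGraph.Adj hH


theorem connected_of_connected_snoc {n : ℕ} {r r' : Fin (n + 1) → Bool} {h : Fin n → Fin 2 → Bool}
    {x : Bool} {y : Fin 2 → Bool} (k : Fin 2 → Fin 2)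
    (hc : (subgrid (Fin.snoc r x : Fin (n + 2) → Bool)
      (Fin.snoc h y : Fin (n + 1) → Fin 2 → Bool)).Connected)
    (hr : ∀ j, r j = true → r' j = true)
    (hx : x = true → (subgrid r' h).Reachable (k 0, Fin.last n) (k 1, Fin.last n))
    (hy : ∀ i, y i = true → (subgrid r' h).Reachable (i, Fin.last n) (k i, Fin.last n)) :
    (subgrid r' h).Connected := by
  let f : Fin 2 × Fin (n + 2) → Fin 2 × Fin (n + 1) := fun v ↦
    Fin.lastCases (motive := fun _ ↦ Fin 2 × Fin (n + 1)) (k v.1, Fin.last n)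
      (fun j ↦ (v.1, j)) v.2
  have hf_last (i) : f (i, Fin.last (n + 1)) = (k i, Fin.last n) := by simp [f]
  have hf_cast (i) (j : Fin (n + 1)) : f (i, j.castSucc) = (i, j) := by simp [f]
  refine hc.of_map_adj_reachable f (forall_adj_subgrid
    (R := fun a b ↦ (subgrid r' h).Reachable (f a) (f b)) (fun _ _ ↦ Reachable.symm) ?_ ?_)
    (fun w ↦ ⟨(w.1, w.2.castSucc), by rw [hf_cast]⟩)
  · refine Fin.lastCases ?_ fun j ↦ ?_
    · simpa only [Fin.snoc_last, hf_last] using hx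
    · rw [Fin.snoc_castSucc, hf_cast, hf_cast]
      exact fun hj ↦ ((subgrid_adj_vertical j).2 (hr j hj)).reachable
  · refine Fin.lastCases ?_ fun j ↦ ?_
    · intro i
      rw [Fin.snoc_last, hf_cast, Fin.succ_last, hf_last]
      exact hy i
    · intro i
      rw [Fin.snoc_castSucc, hf_cast, Fin.succ_castSucc, hf_cast]
      exact fun hj ↦ ((subgrid_adj_horizontal j i).2 hj).reachable

theorem connected_snoc_of_connected {n : ℕ} {r r' : Fin (n + 1) → Bool} {h : Fin n → Fin 2 → Bool}
    {x : Bool} {y : Fin 2 → Bool} (hc : (subgrid r' h).Connected)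
    (hr : ∀ j, r' j = true → (subgrid (Fin.snoc r x : Fin (n + 2) → Bool)
      (Fin.snoc h y : Fin (n + 1) → Fin 2 → Bool)).Reachable (0, j.castSucc) (1, j.castSucc))
    (hxy : ∀ i, y i = true ∨ x = true ∧ ∃ i', y i' = true) :
    (subgrid (Fin.snoc r x : Fin (n + 2) → Bool)
      (Fin.snoc h y : Fin (n + 1) → Fin 2 → Bool)).Connected := by
  have hlast (i : Fin 2) (hi : y i = true) : (subgrid (Fin.snoc r x : Fin (n + 2) → Bool)
      (Fin.snoc h y : Fin (n + 1) → Fin 2 → Bool)).Reachable (i, Fin.last (n + 1))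
      (i, (Fin.last n).castSucc) := by
    rw [← Fin.succ_last]
    exact ((subgrid_adj_horizontal _ _).2 (by simpa using hi)).reachable.symm
  refine hc.of_map_adj_reachable (fun v ↦ (v.1, v.2.castSucc)) (forall_adj_subgrid
    (R := fun a b ↦ (subgrid _ _).Reachable (a.1, a.2.castSucc) (b.1, b.2.castSucc))
    (fun _ _ ↦ Reachable.symm) hr ?_) ?_
  · intro j i hj
    rw [← Fin.succ_castSucc]
    exact ((subgrid_adj_horizontal _ _).2 (by simpa using hj)).reachable
  · rintro ⟨i, j⟩
    refine Fin.lastCases ?_ (fun j ↦ ⟨(i, j), .refl _⟩) j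
    rcases hxy i with hi | ⟨rfl, i', hi'⟩
    · exact ⟨(i, Fin.last n), hlast i hi⟩
    · refine ⟨(i', Fin.last n), Reachable.trans ?_ (hlast i' hi')⟩
      have h01 : (subgrid (Fin.snoc r true : Fin (n + 2) → Bool)
          (Fin.snoc h y : Fin (n + 1) → Fin 2 → Bool)).Reachable (0, Fin.last (n + 1))
          (1, Fin.last (n + 1)) :=
        ((subgrid_adj_vertical _).2 (by simp)).reachable
      match i, i' with
      | 0, 0 => rfl
      | 0, 1 => exact h01
      | 1, 0 => exact h01.symm
      | 1, 1 => rfl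

section Snoc

variable (r h) (x : Bool) (y : Fin 2 → Bool)

theorem connected_snoc_of_all_true (hy : ∀ i, y i = true) :
    (subgrid (Fin.snoc r true : Fin (n + 2) → Bool)
      (Fin.snoc h y : Fin (n + 1) → Fin 2 → Bool)).Connected ↔
    (subgrid (Function.update r (Fin.last n) true) h).Connected := by
  constructor
  · intro hc
    refine connected_of_connected_snoc id hc (fun j hj ↦ ?_) (fun _ ↦ ?_) (fun _ _ ↦ .refl _)
    · rw [Function.update_apply]
      split_ifs <;> simp [hj]
    · exact ((subgrid_adj_vertical _).2 (by simp)).reachable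
  · intro hc
    refine connected_snoc_of_connected hc (fun j hj ↦ ?_) (fun i ↦ .inl (hy i))
    have hh (i) : (subgrid (Fin.snoc r true : Fin (n + 2) → Bool)
      (Fin.snoc h y : Fin (n + 1) → Fin 2 → Bool)).Reachable (i, (Fin.last n).castSucc)
        (i, (Fin.last n).succ) :=
      ((subgrid_adj_horizontal _ _).2 (by simpa using hy i)).reachable
    by_cases hjl : j = Fin.last n
    · subst hjl
      refine (hh 0).trans (Reachable.trans ?_ (hh 1).symm)
      exact ((subgrid_adj_vertical _).2 (by simp)).reachable
    · rw [Function.update_of_ne hjl] at hj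
      exact ((subgrid_adj_vertical _).2 (by simpa using hj)).reachable

theorem connected_snoc_true_of_exists {i : Fin 2} (hi : y i = true)
    (hy : ∀ i', y i' = true → i' = i) :
    (subgrid (Fin.snoc r true : Fin (n + 2) → Bool)
      (Fin.snoc h y : Fin (n + 1) → Fin 2 → Bool)).Connected ↔ (subgrid r h).Connected := by
  constructor
  · intro hc
    refine connected_of_connected_snoc (fun _ ↦ i) hc (fun _ ↦ id) (fun _ ↦ .refl _) ?_
    intro i' hi'
    rw [hy i' hi']
  · intro hc
    refine connected_snoc_of_connected hc (fun j hj ↦ ?_) (fun _ ↦ .inr ⟨rfl, i, hi⟩)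
    exact ((subgrid_adj_vertical _).2 (by simpa using hj)).reachable

theorem connected_snoc_false (hy : ∀ i, y i = true) :
    (subgrid (Fin.snoc r false : Fin (n + 2) → Bool)
      (Fin.snoc h y : Fin (n + 1) → Fin 2 → Bool)).Connected ↔ (subgrid r h).Connected := by
  constructor
  · intro hc
    exact connected_of_connected_snoc id hc (fun _ ↦ id) (fun h ↦ nomatch h) (fun _ _ ↦ .refl _)
  · intro hc
    refine connected_snoc_of_connected hc (fun j hj ↦ ?_) (fun i ↦ .inl (hy i))
    exact ((subgrid_adj_vertical _).2 (by simpa using hj)).reachable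

theorem not_connected_snoc_of_isolated_column (hy : ∀ i, y i = false) :
    ¬ (subgrid (Fin.snoc r x : Fin (n + 2) → Bool)
      (Fin.snoc h y : Fin (n + 1) → Fin 2 → Bool)).Connected := by
  intro hc
  have := (hc.preconnected (0, Fin.last (n + 1)) (0, 0)).iff_of_adj
    (fun v ↦ v.2 = Fin.last (n + 1)) (forall_adj_subgrid
      (R := fun a b ↦ a.2 = Fin.last (n + 1) ↔ b.2 = Fin.last (n + 1))
      (fun _ _ ↦ Iff.symm) (fun _ _ ↦ .rfl) ?_)
  · exact absurd (this.1 rfl) (by simp [Fin.ext_iff])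
  · refine Fin.lastCases (fun i ↦ by simp [hy]) fun j i _ ↦ ?_
    simp [Fin.ext_iff, j.isLt.ne, (j.isLt.trans (Nat.lt_succ_self n)).ne]

theorem not_connected_snoc_of_isolated_vertex {i : Fin 2} (hi : y i = false) :
    ¬ (subgrid (Fin.snoc r false : Fin (n + 2) → Bool)
      (Fin.snoc h y : Fin (n + 1) → Fin 2 → Bool)).Connected := by
  intro hc
  have := (hc.preconnected (i, Fin.last (n + 1)) (i, 0)).iff_of_adj
    (fun v ↦ v = (i, Fin.last (n + 1))) (forall_adj_subgrid
      (R := fun a b ↦ a = (i, Fin.last (n + 1)) ↔ b = (i, Fin.last (n + 1)))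
      (fun _ _ ↦ Iff.symm) ?_ ?_)
  · exact absurd (this.1 rfl) (by simp [Fin.ext_iff])
  · refine Fin.lastCases (by simp) fun j _ ↦ ?_
    simp [Fin.ext_iff, j.isLt.ne]
  · refine Fin.lastCases (fun i' hi' ↦ ?_) fun j i' _ ↦ ?_
    · have : i' ≠ i := by rintro rfl; simp [hi] at hi'
      simp [this]
    · simp [Fin.ext_iff, j.isLt.ne, (j.isLt.trans (Nat.lt_succ_self n)).ne]

end Snoc

theorem card_subtype_snoc (n : ℕ)
    (P : (Fin (n + 2) → Bool) × (Fin (n + 1) → Fin 2 → Bool) → Prop) :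
    Nat.card {c // P c} = ∑ t : Bool × Bool × Bool,
      Nat.card {c : (Fin (n + 1) → Bool) × (Fin n → Fin 2 → Bool) //
        P (Fin.snoc c.1 t.1, Fin.snoc c.2 ![t.2.1, t.2.2])} := by
  rw [← Nat.card_sigma]
  refine (Nat.card_congr (Equiv.ofBijective
    (fun s ↦ ⟨(Fin.snoc s.2.1.1 s.1.1, Fin.snoc s.2.1.2 ![s.1.2.1, s.1.2.2]), s.2.2⟩)
    ⟨?_, ?_⟩)).symm
  · rintro ⟨⟨x, a, b⟩, ⟨r, h⟩, hc⟩ ⟨⟨x', a', b'⟩, ⟨r', h'⟩, hc'⟩ heq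
    simp only [Subtype.mk.injEq, Prod.mk.injEq] at heq
    obtain ⟨rfl, rfl⟩ := Fin.snoc_injective2 heq.1
    obtain ⟨rfl, hab⟩ := Fin.snoc_injective2 heq.2
    obtain rfl : a = a' := congrFun hab 0
    obtain rfl : b = b' := congrFun hab 1
    rfl
  · rintro ⟨⟨r, h⟩, hc⟩
    have hh : (Fin.snoc (Fin.init h) ![h (Fin.last n) 0, h (Fin.last n) 1] :
        Fin (n + 1) → Fin 2 → Bool) = h := by
      conv_rhs => rw [← Fin.snoc_init_self h]
      congr 1
      ext i
      fin_cases i <;> rfl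
    have hr : (Fin.snoc (Fin.init r) (r (Fin.last _)) : Fin (n + 2) → Bool) = r :=
      Fin.snoc_init_self r
    exact ⟨⟨(r (Fin.last _), h (Fin.last n) 0, h (Fin.last n) 1), (Fin.init r, Fin.init h),
      by rw [hh, hr]; exact hc⟩, Subtype.ext (Prod.ext hr hh)⟩

/-- The subgraph of the `2 × (n + 1)` grid encoded by `c` is a spanning tree. -/
def IsSpanningTree {n : ℕ} (c : (Fin (n + 1) → Bool) × (Fin n → Fin 2 → Bool)) : Prop :=
  (subgrid c.1 c.2).Connected ∧ (subgrid c.1 c.2).edgeSet.ncard + 1 = 2 * (n + 1)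

/-- The subgraph of the `2 × (n + 1)` grid encoded by `c` is a spanning forest with two
components which separate the two vertices of the last column. -/
def IsSplitForest {n : ℕ} (c : (Fin (n + 1) → Bool) × (Fin n → Fin 2 → Bool)) : Prop :=
  (subgrid (Function.update c.1 (Fin.last n) true) c.2).Connected ∧
    (subgrid c.1 c.2).edgeSet.ncard + 2 = 2 * (n + 1)

theorem gridForestCount_succ (n : ℕ) : gridForestCount (n + 1) =
    Nat.card {c : (Fin (n + 1) → Bool) × (Fin n → Fin 2 → Bool) // IsSplitForest c} := by
  rw [gridForestCount, card_spanning_subgraph n fun G ↦ G.IsAcyclic ∧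
    Nat.card G.ConnectedComponent = 2 ∧ ¬ G.Reachable (0, Fin.last n) (1, Fin.last n)]
  refine Nat.card_congr (Equiv.subtypeEquivRight fun c ↦ ?_)
  rw [isAcyclic_and_card_connectedComponent_eq_two_iff (by simp), IsSplitForest,
    subgrid_update_last, Nat.card_prod, Nat.card_fin, Nat.card_fin]

theorem two_mul_le_ncard_of_connected (hc : (subgrid r h).Connected) :
    2 * (n + 1) ≤ (subgrid r h).edgeSet.ncard + 1 := by
  simpa using hc.card_vert_le_card_edgeSet_add_one

theorem two_mul_le_ncard_of_connected_update
    (hc : (subgrid (Function.update r (Fin.last n) true) h).Connected) :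
    2 * (n + 1) ≤ (subgrid r h).edgeSet.ncard + 2 := by
  refine (two_mul_le_ncard_of_connected hc).trans ?_
  rw [subgrid_update_last, edgeSet_sup_edge (by simp)]
  exact Nat.succ_le_succ (Set.ncard_insert_le _ _)

theorem ncard_edgeSet_subgrid_snoc (x : Bool) (y : Fin 2 → Bool) :
    (subgrid (Fin.snoc r x : Fin (n + 2) → Bool)
      (Fin.snoc h y : Fin (n + 1) → Fin 2 → Bool)).edgeSet.ncard =
    (subgrid r h).edgeSet.ncard + x.toNat + (y 0).toNat + (y 1).toNat := by
  rw [ncard_edgeSet_subgrid, ncard_edgeSet_subgrid, Fin.sum_univ_castSucc,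
    Fin.sum_univ_castSucc (fun j ↦ ((Fin.snoc h y : Fin (n + 1) → Fin 2 → Bool) j 0).toNat + _)]
  simp only [Fin.snoc_castSucc, Fin.snoc_last]
  ring

theorem connected_snoc_iff (x a b : Bool) :
    (subgrid (Fin.snoc r x : Fin (n + 2) → Bool)
      (Fin.snoc h ![a, b] : Fin (n + 1) → Fin 2 → Bool)).Connected ↔
    match x, a, b with
    | true, true, true => (subgrid (Function.update r (Fin.last n) true) h).Connected
    | true, true, false | true, false, true | false, true, true => (subgrid r h).Connected
    | _, _, _ => False := by
  match x, a, b with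
  | true, true, true => exact connected_snoc_of_all_true r h _ (by simp [Fin.forall_fin_two])
  | true, true, false =>
    exact connected_snoc_true_of_exists r h _ (i := 0) rfl (by simp [Fin.forall_fin_two])
  | true, false, true =>
    exact connected_snoc_true_of_exists r h _ (i := 1) rfl (by simp [Fin.forall_fin_two])
  | false, true, true => exact connected_snoc_false r h _ (by simp [Fin.forall_fin_two])
  | x, false, false =>
    have := not_connected_snoc_of_isolated_column r h x ![false, false]
      (by simp [Fin.forall_fin_two])
    cases x <;> simpa using this
  | false, true, false =>
    simpa using not_connected_snoc_of_isolated_vertex r h ![true, false] (i := 1) rfl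
  | false, false, true =>
    simpa using not_connected_snoc_of_isolated_vertex r h ![false, true] (i := 0) rfl

theorem isSpanningTree_snoc_iff (c : (Fin (n + 1) → Bool) × (Fin n → Fin 2 → Bool))
    (x a b : Bool) :
    IsSpanningTree ((Fin.snoc c.1 x, Fin.snoc c.2 ![a, b]) :
      (Fin (n + 2) → Bool) × (Fin (n + 1) → Fin 2 → Bool)) ↔
    match x, a, b with
    | true, true, true => IsSplitForest c
    | true, true, false | true, false, true | false, true, true => IsSpanningTree c
    | _, _, _ => False := by
  rw [IsSpanningTree, connected_snoc_iff, ncard_edgeSet_subgrid_snoc]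
  cases x <;> cases a <;> cases b <;>
    simp only [false_and, IsSpanningTree, IsSplitForest] <;>
    refine and_congr_right fun _ ↦ ?_ <;> simp <;> omega

theorem isSplitForest_snoc_iff (c : (Fin (n + 1) → Bool) × (Fin n → Fin 2 → Bool))
    (x a b : Bool) :
    IsSplitForest ((Fin.snoc c.1 x, Fin.snoc c.2 ![a, b]) :
      (Fin (n + 2) → Bool) × (Fin (n + 1) → Fin 2 → Bool)) ↔
    match x, a, b with
    | false, true, true => IsSplitForest c
    | false, true, false | false, false, true => IsSpanningTree c
    | _, _, _ => False := by
  rw [IsSplitForest, Fin.update_snoc_last, connected_snoc_iff, ncard_edgeSet_subgrid_snoc]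
  have h₁ := two_mul_le_ncard_of_connected (r := c.1) (h := c.2)
  have h₂ := two_mul_le_ncard_of_connected_update (r := c.1) (h := c.2)
  cases x <;> cases a <;> cases b <;>
    simp only [false_and, IsSpanningTree, IsSplitForest, iff_false, not_and] <;>
    first
    | (refine and_congr_right fun _ ↦ ?_; simp; omega)
    | (intro hc; have := h₁ hc; simp; omega)
    | (intro hc; have := h₂ hc; simp; omega)

theorem card_isSpanningTree_succ (n : ℕ) :
    Nat.card {c : (Fin (n + 2) → Bool) × (Fin (n + 1) → Fin 2 → Bool) // IsSpanningTree c} =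
      3 * Nat.card {c : (Fin (n + 1) → Bool) × (Fin n → Fin 2 → Bool) // IsSpanningTree c} +
        Nat.card {c : (Fin (n + 1) → Bool) × (Fin n → Fin 2 → Bool) // IsSplitForest c} := by
  simp only [card_subtype_snoc, isSpanningTree_snoc_iff, Fintype.sum_prod_type, Fintype.sum_bool,
    Nat.card_of_isEmpty]
  ring

theorem card_isSplitForest_succ (n : ℕ) :
    Nat.card {c : (Fin (n + 2) → Bool) × (Fin (n + 1) → Fin 2 → Bool) // IsSplitForest c} =
      2 * Nat.card {c : (Fin (n + 1) → Bool) × (Fin n → Fin 2 → Bool) // IsSpanningTree c} +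
        Nat.card {c : (Fin (n + 1) → Bool) × (Fin n → Fin 2 → Bool) // IsSplitForest c} := by
  simp only [card_subtype_snoc, isSplitForest_snoc_iff, Fintype.sum_prod_type, Fintype.sum_bool,
    Nat.card_of_isEmpty]
  ring

theorem connected_subgrid_zero_iff (r : Fin 1 → Bool) (h : Fin 0 → Fin 2 → Bool) :
    (subgrid r h).Connected ↔ r 0 = true := by
  constructor
  · intro hc
    have := two_mul_le_ncard_of_connected hc
    rw [ncard_edgeSet_subgrid] at this
    by_contra hr
    simp [Bool.eq_false_of_not_eq_true hr] at this
  · intro hr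
    have h01 := ((subgrid_adj_vertical (h := h) 0).2 hr).reachable
    refine (connected_iff_exists_forall_reachable _).2 ⟨(0, 0), ?_⟩
    rintro ⟨i, j⟩
    obtain rfl : j = 0 := Subsingleton.elim (α := Fin 1) _ _
    match i with
    | 0 => rfl
    | 1 => exact h01

theorem card_isSpanningTree_zero :
    Nat.card {c : (Fin 1 → Bool) × (Fin 0 → Fin 2 → Bool) // IsSpanningTree c} = 1 := by
  refine Nat.card_eq_one_iff_exists.2 ⟨⟨(fun _ ↦ true, Fin.elim0), ?_⟩, ?_⟩
  · rw [IsSpanningTree, connected_subgrid_zero_iff, ncard_edgeSet_subgrid]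
    simp
  · rintro ⟨⟨r, h⟩, hc⟩
    have := (connected_subgrid_zero_iff r h).1 hc.1
    refine Subtype.ext (Prod.ext (funext fun j ↦ ?_) (Subsingleton.elim _ _))
    rw [Subsingleton.elim (α := Fin 1) j 0]
    exact this

theorem card_isSplitForest_zero :
    Nat.card {c : (Fin 1 → Bool) × (Fin 0 → Fin 2 → Bool) // IsSplitForest c} = 1 := by
  refine Nat.card_eq_one_iff_exists.2 ⟨⟨(fun _ ↦ false, Fin.elim0), ?_⟩, ?_⟩
  · rw [IsSplitForest, connected_subgrid_zero_iff, ncard_edgeSet_subgrid]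
    simp
  · rintro ⟨⟨r, h⟩, hc⟩
    have := hc.2
    rw [ncard_edgeSet_subgrid] at this
    refine Subtype.ext (Prod.ext (funext fun j ↦ ?_) (Subsingleton.elim _ _))
    rw [Subsingleton.elim (α := Fin 1) j 0]
    simpa using this

end GridForest

open GridForest

theorem gridForestCount_recurrence :
    gridForestCount 1 = 1 ∧ gridForestCount 2 = 3 ∧
      ∀ n : ℕ, 3 ≤ n →
        (gridForestCount n : ℤ) =
          4 * gridForestCount (n - 1) - gridForestCount (n - 2) := by
  refine ⟨?_, ?_, fun n hn ↦ ?_⟩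
  · rw [gridForestCount_succ, card_isSplitForest_zero]
  · rw [gridForestCount_succ, card_isSplitForest_succ, card_isSplitForest_zero,
      card_isSpanningTree_zero]
  · obtain ⟨n, rfl⟩ := Nat.exists_eq_add_of_le' hn
    rw [show n + 3 - 1 = n + 1 + 1 by omega, show n + 3 - 2 = n + 1 by omega]
    simp only [gridForestCount_succ]
    have h₁ := card_isSplitForest_succ (n + 1)
    have h₂ := card_isSplitForest_succ n
    have h₃ := card_isSpanningTree_succ n
    lia
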